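/- Let (φ_n)_{n≥0} be the standard Hermite functions on ℝ. Then for all r ≥ 1/2, ε > 0, and nonnegative integers n ≥ 1, k, l: ‖x^k ∂_x^l φ_n‖_{L²(ℝ)} ≤ √2 · exp(ε r n^{1/(2r)}) · (2^{r+1} e^r / min(ε^r, 1))^{k+l} · (k!)^r (l!)^r. -/

import Mathlib

open MeasureTheory Nat

/-- The standard Hermite functions `φ_n = a₊ⁿ φ₀ / √(n!)`, where
`a₊ = (x - d/dx)/√2` and `φ₀(x) = π^{-1/4} e^{-x²/2}`. -/
noncomputable def hermiteFun : ℕ → ℝ → ℝ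
  | 0 => fun x => Real.pi ^ (-(1 : ℝ) / 4) * Real.exp (-x ^ 2 / 2)
  | n + 1 => fun x =>
      (Real.sqrt (2 * (n + 1)))⁻¹ * (x * hermiteFun n x - deriv (hermiteFun n) x)

lemma hermiteFun_rep (n : ℕ) : ∃ P : Polynomial ℝ,
    hermiteFun n = fun x => P.eval x * Real.exp (-x ^ 2 / 2) := by
  induction n with
  | zero => exact ⟨Polynomial.C (Real.pi ^ (-(1 : ℝ) / 4)), by ext x; simp [hermiteFun]⟩
  | succ n ih =>
    obtain ⟨P, hP⟩ := ih
    refine ⟨Polynomial.C (Real.sqrt (2 * (n + 1)))⁻¹ *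
      (Polynomial.X * P - (Polynomial.derivative P - Polynomial.X * P)), ?_⟩
    ext x
    have h1 : HasDerivAt (fun x : ℝ => Real.exp (-x ^ 2 / 2))
        (Real.exp (-x ^ 2 / 2) * (-x)) x := by
      have h0 : HasDerivAt (fun x : ℝ => -x ^ 2 / 2) (-x) x := by
        have := ((hasDerivAt_pow 2 x).neg.div_const 2)
        refine this.congr_deriv ?_
        simp
        ring
      exact h0.exp
    have h2 := (P.hasDerivAt x).mul h1
    have h3 : deriv (hermiteFun n) x = P.derivative.eval x * Real.exp (-x ^ 2 / 2) +
        P.eval x * (Real.exp (-x ^ 2 / 2) * -x) := by rw [hP]; exact h2.deriv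
    rw [hermiteFun]
    beta_reduce
    rw [h3, hP]
    simp
    ring

lemma hermiteFun_contDiff (n : ℕ) : ContDiff ℝ (⊤ : ℕ∞) (hermiteFun n) := by
  obtain ⟨P, hP⟩ := hermiteFun_rep n
  rw [hP]
  have : ContDiff ℝ (⊤ : ℕ∞) (fun x => P.eval x) := by
    simpa using P.contDiff_aeval (n := (⊤ : ℕ∞)) (𝕜 := ℝ)
  fun_prop

lemma hermiteFun_diff (n : ℕ) : Differentiable ℝ (hermiteFun n) :=
  (hermiteFun_contDiff n).differentiable (by simp)

lemma hermiteFun_create (n : ℕ) (x : ℝ) :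
    x * hermiteFun n x - deriv (hermiteFun n) x = Real.sqrt (2 * (n + 1)) * hermiteFun (n + 1) x := by
  have : Real.sqrt (2 * ((n : ℝ) + 1)) ≠ 0 := by positivity
  rw [hermiteFun]
  field_simp

lemma hermiteFun_annih (n : ℕ) : ∀ x : ℝ,
    x * hermiteFun n x + deriv (hermiteFun n) x = Real.sqrt (2 * n) * hermiteFun (n - 1) x := by
  induction n with
  | zero =>
    intro x
    have h1 : HasDerivAt (fun x : ℝ => Real.exp (-x ^ 2 / 2))
        (Real.exp (-x ^ 2 / 2) * (-x)) x := by
      have h0 : HasDerivAt (fun x : ℝ => -x ^ 2 / 2) (-x) x := by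
        have := ((hasDerivAt_pow 2 x).neg.div_const 2)
        refine this.congr_deriv ?_
        simp
        ring
      exact h0.exp
    have h2 := (h1.const_mul (Real.pi ^ (-(1 : ℝ) / 4))).deriv
    have h3 : deriv (hermiteFun 0) x =
        Real.pi ^ (-(1 : ℝ) / 4) * (Real.exp (-x ^ 2 / 2) * -x) := by
      rw [hermiteFun]; exact h2
    rw [h3]
    simp [hermiteFun]
    ring
  | succ n ih =>
    intro x
    set s := Real.sqrt (2 * ((n : ℝ) + 1)) with hs
    have hs0 : s ≠ 0 := by positivity
    have hss : s * s = 2 * ((n : ℝ) + 1) := Real.mul_self_sqrt (by positivity)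
    have hd := (hermiteFun_diff n x).hasDerivAt
    have hdd : Differentiable ℝ (deriv (hermiteFun n)) :=
      (contDiff_infty.1 (hermiteFun_contDiff n) 2).differentiable_deriv_two
    have hd2 := (hdd x).hasDerivAt
    -- derivative of the successor
    have e1 : deriv (hermiteFun (n + 1)) x =
        s⁻¹ * (hermiteFun n x + x * deriv (hermiteFun n) x - deriv (deriv (hermiteFun n)) x) := by
      have := ((((hasDerivAt_id x).mul hd).sub hd2).const_mul s⁻¹).deriv
      rw [hermiteFun]
      refine this.trans ?_
      simp
    -- derivative of the annihilation identity
    have e2 : hermiteFun n x + x * deriv (hermiteFun n) x + deriv (deriv (hermiteFun n)) x =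
        Real.sqrt (2 * n) * deriv (hermiteFun (n - 1)) x := by
      have h1 := ((hasDerivAt_id x).mul hd).add hd2
      have h2 := ((hermiteFun_diff (n - 1) x).hasDerivAt).const_mul (Real.sqrt (2 * n))
      have h3 : (id * hermiteFun n + deriv (hermiteFun n)) =
          fun x => Real.sqrt (2 * n) * hermiteFun (n - 1) x := by
        ext y; simpa using ih y
      rw [h3] at h1
      have := h1.unique h2
      simpa using this
    have e3 : Real.sqrt (2 * n) * (x * hermiteFun (n - 1) x - deriv (hermiteFun (n - 1)) x)
        = 2 * n * hermiteFun n x := by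
      rcases n with _ | m
      · simp
      · have h := hermiteFun_create m x
        have h5 : Real.sqrt (2 * ((m : ℝ) + 1)) * Real.sqrt (2 * ((m : ℝ) + 1)) = _ :=
          Real.mul_self_sqrt (by positivity)
        simp only [Nat.add_sub_cancel]
        push_cast
        rw [h, ← mul_assoc, h5]
    have e4 := ih x
    have e5 : hermiteFun (n + 1) x = s⁻¹ * (x * hermiteFun n x - deriv (hermiteFun n) x) := by
      rw [hermiteFun]
    simp only [Nat.add_sub_cancel]
    push_cast
    rw [← hs, e1, e5]
    field_simp
    rw [pow_two, hss]
    linear_combination e3 + x * e4 - e2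

lemma poly_gauss_integrable (P : Polynomial ℝ) :
    Integrable (fun x => P.eval x * Real.exp (-x ^ 2)) volume := by
  induction P using Polynomial.induction_on' with
  | add p q hp hq =>
    refine (hp.add hq).congr (Filter.Eventually.of_forall fun x => ?_)
    simp [add_mul]
  | monomial n a =>
    have := (integrable_rpow_mul_exp_neg_mul_sq (b := 1) one_pos
      (s := n) (by have : (0:ℝ) ≤ n := by positivity
                   linarith)).const_mul a
    simpa [mul_assoc] using this

lemma hermiteFun_mul_integrable (n m : ℕ) :
    Integrable (fun x => hermiteFun n x * hermiteFun m x) volume := by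
  obtain ⟨P, hP⟩ := hermiteFun_rep n
  obtain ⟨Q, hQ⟩ := hermiteFun_rep m
  have := poly_gauss_integrable (P * Q)
  convert this using 2 with x
  rw [hP, hQ, show -x ^ 2 = -x ^ 2 / 2 + -x ^ 2 / 2 by ring, Real.exp_add, Polynomial.eval_mul]
  ring

lemma hermiteFun_norm (n : ℕ) : ∫ x, hermiteFun n x * hermiteFun n x = 1 := by
  induction n with
  | zero =>
    have h : ∀ x, hermiteFun 0 x * hermiteFun 0 x =
        (Real.sqrt Real.pi)⁻¹ * Real.exp (-1 * x ^ 2) := by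
      intro x
      rw [show -1 * x ^ 2 = -x ^ 2 / 2 + -x ^ 2 / 2 by ring, Real.exp_add]
      have : (Real.sqrt Real.pi)⁻¹ = Real.pi ^ (-(1 : ℝ) / 4) * Real.pi ^ (-(1 : ℝ) / 4) := by
        rw [← Real.rpow_add Real.pi_pos, Real.sqrt_eq_rpow, ← Real.rpow_neg Real.pi_pos.le]
        norm_num
      rw [this, hermiteFun]
      ring
    simp_rw [h]
    rw [integral_const_mul, integral_gaussian, div_one]
    have : Real.sqrt Real.pi ≠ 0 := (Real.sqrt_pos.2 Real.pi_pos).ne'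
    field_simp
  | succ n ih =>
    set s := Real.sqrt (2 * ((n : ℝ) + 1)) with hs
    have hs0 : s ≠ 0 := by positivity
    have hi1 := (hermiteFun_mul_integrable n n).const_mul s
    have hi2 := (hermiteFun_mul_integrable (n+1) (n+1)).const_mul s
    have key : ∫ x, (s * (hermiteFun n x * hermiteFun n x) -
        s * (hermiteFun (n+1) x * hermiteFun (n+1) x)) = 0 := by
      refine integral_eq_zero_of_hasDerivAt_of_integrable
        (f := fun x => hermiteFun n x * hermiteFun (n+1) x) ?_ (hi1.sub hi2)
        (hermiteFun_mul_integrable _ _)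
      intro x
      have h := (hermiteFun_diff n x).hasDerivAt.mul (hermiteFun_diff (n+1) x).hasDerivAt
      refine h.congr_deriv ?_
      have a1 := hermiteFun_create n x
      have a2 := hermiteFun_annih (n+1) x
      simp only [Nat.add_sub_cancel] at a2
      push_cast at a2
      rw [← hs] at a1 a2
      linear_combination hermiteFun n x * a2 - hermiteFun (n+1) x * a1
    rw [integral_sub hi1 hi2, integral_const_mul, integral_const_mul, ih] at key
    have : s * (1 - ∫ x, hermiteFun (n+1) x * hermiteFun (n+1) x) = 0 := by linarith
    rcases mul_eq_zero.1 this with h | h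
    · exact absurd h hs0
    · linarith

lemma hermiteFun_eLpNorm (n : ℕ) : eLpNorm (hermiteFun n) 2 volume = 1 := by
  have hc : Continuous (hermiteFun n) := (hermiteFun_diff n).continuous
  have hm : MemLp (hermiteFun n) 2 volume := by
    rw [memLp_two_iff_integrable_sq hc.aestronglyMeasurable]
    simpa [pow_two] using hermiteFun_mul_integrable n n
  rw [hm.eLpNorm_eq_integral_rpow_norm (by simp) (by simp)]
  have : ∀ x, ‖hermiteFun n x‖ ^ (2 : ENNReal).toReal = hermiteFun n x * hermiteFun n x := by
    intro x
    simp [pow_two]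
  simp_rw [this, hermiteFun_norm]
  simp

lemma step_bound (f g h : ℝ → ℝ) (a b G H B : ℝ) (hg : Continuous g) (hh : Continuous h)
    (ha : 0 ≤ a) (hb : 0 ≤ |b|) (hG0 : 0 ≤ G) (hH0 : 0 ≤ H)
    (hf : ∀ x, f x = a * g x + b * h x)
    (hG : eLpNorm g 2 volume ≤ ENNReal.ofReal G) (hH : eLpNorm h 2 volume ≤ ENNReal.ofReal H)
    (hB : a * G + |b| * H ≤ B) : eLpNorm f 2 volume ≤ ENNReal.ofReal B := by
  have e : f = a • g + b • h := by ext x; simp [hf]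
  rw [e]
  refine (eLpNorm_add_le (hg.const_smul a).aestronglyMeasurable
    (hh.const_smul b).aestronglyMeasurable (by norm_num)).trans ?_
  rw [eLpNorm_const_smul, eLpNorm_const_smul]
  refine le_trans ?_ (ENNReal.ofReal_le_ofReal hB)
  rw [ENNReal.ofReal_add (by positivity) (by positivity), ENNReal.ofReal_mul ha,
    ENNReal.ofReal_mul hb, Real.enorm_eq_ofReal_abs, Real.enorm_eq_ofReal_abs, abs_of_nonneg ha]
  gcongr

lemma coef_bound (n m : ℕ) :
    Real.sqrt (2 * n) / 2 * Real.sqrt (2 * ((n - 1 : ℕ) + m)) ^ m +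
      Real.sqrt (2 * (n + 1)) / 2 * Real.sqrt (2 * ((n + 1 : ℕ) + m)) ^ m ≤
    Real.sqrt (2 * (n + (m + 1 : ℕ))) ^ (m + 1) := by
  have hm : (0 : ℝ) ≤ m := by positivity
  have h0 : ((n - 1 : ℕ) : ℝ) ≤ n := by exact_mod_cast Nat.sub_le n 1
  set S := Real.sqrt (2 * ((n : ℝ) + (m + 1 : ℕ))) with hS
  have h1 : Real.sqrt (2 * n) ≤ S := Real.sqrt_le_sqrt (by push_cast; linarith)
  have h2 : Real.sqrt (2 * ((n - 1 : ℕ) + m)) ≤ S := Real.sqrt_le_sqrt (by push_cast; linarith)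
  have h3 : Real.sqrt (2 * ((n:ℝ) + 1)) ≤ S := Real.sqrt_le_sqrt (by push_cast; linarith)
  have h4 : Real.sqrt (2 * ((n + 1 : ℕ) + m)) ≤ S := Real.sqrt_le_sqrt (by push_cast; linarith)
  calc _ ≤ S / 2 * S ^ m + S / 2 * S ^ m := by gcongr
    _ = S ^ (m + 1) := by ring

lemma hermiteFun_iter_cont (n k l : ℕ) :
    Continuous (fun x : ℝ => x ^ k * iteratedDeriv l (hermiteFun n) x) :=
  (continuous_pow k).mul ((hermiteFun_contDiff n).continuous_iteratedDeriv l (by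
    exact_mod_cast le_top))

lemma hermite_crude (k l : ℕ) : ∀ n : ℕ,
    eLpNorm (fun x : ℝ => x ^ k * iteratedDeriv l (hermiteFun n) x) 2 volume ≤
      ENNReal.ofReal (Real.sqrt (2 * (n + (k + l : ℕ))) ^ (k + l)) := by
  induction l with
  | zero =>
    induction k with
    | zero => intro n; simp [hermiteFun_eLpNorm]
    | succ k ih =>
      intro n
      refine step_bound _ _ _ (Real.sqrt (2 * n) / 2) (Real.sqrt (2 * (n + 1)) / 2) _ _ _
        (hermiteFun_iter_cont (n - 1) k 0) (hermiteFun_iter_cont (n + 1) k 0)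
        (by positivity) (by positivity) (by positivity) (by positivity) ?_ (ih _) (ih _) ?_
      · intro x
        simp only [iteratedDeriv_zero]
        have a1 := hermiteFun_create n x
        have a2 := hermiteFun_annih n x
        linear_combination x ^ k / 2 * (a1 + a2)
      · rw [abs_of_nonneg (by positivity)]
        exact coef_bound n k
  | succ l ih =>
    intro n
    refine step_bound _ _ _ (Real.sqrt (2 * n) / 2) (-(Real.sqrt (2 * (n + 1)) / 2)) _ _ _
      (hermiteFun_iter_cont (n - 1) k l) (hermiteFun_iter_cont (n + 1) k l)
      (by positivity) (by positivity) (by positivity) (by positivity) ?_ (ih _) (ih _) ?_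
    · intro x
      have hd : deriv (hermiteFun n) = fun x => (Real.sqrt (2 * n) / 2) * hermiteFun (n - 1) x +
          (-(Real.sqrt (2 * (n + 1)) / 2)) * hermiteFun (n + 1) x := by
        ext x
        have a1 := hermiteFun_create n x
        have a2 := hermiteFun_annih n x
        linear_combination (a2 - a1) / 2
      have hc : ∀ j, ContDiff ℝ l (hermiteFun j) := fun j =>
        (hermiteFun_contDiff j).of_le (by exact_mod_cast le_top)
      rw [iteratedDeriv_succ', hd, iteratedDeriv_fun_add, iteratedDeriv_const_mul_field,
        iteratedDeriv_const_mul_field]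
      · ring
      · exact (contDiff_const.mul (hc _)).contDiffAt
      · exact (contDiff_const.mul (hc _)).contDiffAt
    · rw [abs_neg, abs_of_nonneg (by positivity)]
      exact coef_bound n (k + l)

lemma fact_bound (k l : ℕ) : ((k + l)! : ℝ) ≤ 2 ^ (k + l) * (k ! * l !) := by
  have h := Nat.add_choose_mul_factorial_mul_factorial k l
  have h2 := Nat.choose_le_two_pow (k + l) l
  rw [← h]
  push_cast
  rw [mul_assoc]
  gcongr
  exact_mod_cast h2

lemma num_aux (S t c F E r K X : ℝ) (m : ℕ) (hS0 : 0 ≤ S) (ht : 0 ≤ t) (hc : 0 ≤ c) (hF : 0 ≤ F)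
    (hE : 0 ≤ E) (hr : 0 ≤ r) (hS : S ≤ 2 * t ^ r) (h : t ^ m ≤ c ^ m * F * E)
    (hK : 2 * c ^ r ≤ K) (hX : E ^ r ≤ X) : S ^ m ≤ X * K ^ m * F ^ r := by
  have e : (t ^ r) ^ m = (t ^ m) ^ r := by
    rw [← Real.rpow_natCast, ← Real.rpow_natCast, ← Real.rpow_mul ht, ← Real.rpow_mul ht, mul_comm]
  have e' : (c ^ r) ^ m = (c ^ m) ^ r := by
    rw [← Real.rpow_natCast, ← Real.rpow_natCast, ← Real.rpow_mul hc, ← Real.rpow_mul hc, mul_comm]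
  have hX0 : 0 ≤ X := le_trans (by positivity) hX
  calc S ^ m ≤ (2 * t ^ r) ^ m := by gcongr
    _ = 2 ^ m * (t ^ m) ^ r := by rw [mul_pow, e]
    _ ≤ 2 ^ m * (c ^ m * F * E) ^ r := by gcongr
    _ = E ^ r * (2 * c ^ r) ^ m * F ^ r := by
        rw [Real.mul_rpow (by positivity) hE, Real.mul_rpow (by positivity) hF, ← e', mul_pow]
        ring
    _ ≤ X * K ^ m * F ^ r := by gcongr

lemma num_bound (r ε : ℝ) (hr : 1 / 2 ≤ r) (hε : 0 < ε) (n k l : ℕ) (hn : 1 ≤ n) :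
    Real.sqrt (2 * (n + (k + l : ℕ))) ^ (k + l) ≤
      Real.exp (ε * r * (n : ℝ) ^ (1 / (2 * r))) *
        (2 ^ (r + 1) * Real.exp 1 ^ r / min (ε ^ r) 1) ^ (k + l) * ((k ! : ℝ) * (l ! : ℝ)) ^ r := by
  have hr0 : 0 < r := by linarith
  have hεr : 0 < ε ^ r := by positivity
  have hmin : 0 < min (ε ^ r) 1 := lt_min hεr one_pos
  have he1 : 1 ≤ Real.exp 1 ^ r := Real.one_le_rpow (by simp) hr0.le
  have hfac := fact_bound k l
  generalize hm : k + l = m at *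
  rcases le_or_gt m n with hmn | hmn
  · have hmn' : (m : ℝ) ≤ n := by exact_mod_cast hmn
    set t := (n : ℝ) ^ (1 / (2 * r)) with ht
    have ht0 : 0 ≤ t := by positivity
    refine num_aux _ t (2 / ε) _ (Real.exp (ε * t)) r _ _ m (by positivity) ht0 (by positivity)
      (by positivity) (by positivity) hr0.le ?_ ?_ ?_ ?_
    · have : t ^ r = Real.sqrt n := by
        rw [ht, ← Real.rpow_mul (by positivity), Real.sqrt_eq_rpow]
        congr 1
        field_simp
      rw [this]
      apply Real.sqrt_le_iff.2 ⟨by positivity, ?_⟩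
      rw [mul_pow, Real.sq_sqrt (by positivity)]
      linarith
    · have h := Real.pow_div_factorial_le_exp (ε * t) (by positivity) m
      rw [div_le_iff₀ (by positivity), mul_pow] at h
      rw [div_pow]
      have h2 : ε ^ m * t ^ m ≤ 2 ^ m * (k ! * l !) * Real.exp (ε * t) := by
        refine h.trans ?_
        rw [mul_comm]
        gcongr
      rw [show (2:ℝ) ^ m / ε ^ m * (k ! * l !) * Real.exp (ε * t) =
        (2 ^ m * (k ! * l !) * Real.exp (ε * t)) / ε ^ m by ring, le_div_iff₀ (by positivity)]
      linarith
    · rw [Real.div_rpow (by norm_num) hε.le, Real.rpow_add_one (by norm_num),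
        show (2:ℝ) * (2 ^ r / ε ^ r) = 2 ^ r * 2 * 1 / ε ^ r by ring]
      gcongr
      exact min_le_left _ _
    · rw [← Real.exp_mul]
      apply le_of_eq
      congr 1
      ring
  · have hmn' : (n : ℝ) ≤ m := by exact_mod_cast hmn.le
    have hm1 : (1 : ℝ) ≤ m := by exact_mod_cast (by omega : 1 ≤ m)
    refine num_aux _ m (2 * Real.exp 1) _ 1 r _ _ m (by positivity) (by positivity) (by positivity)
      (by positivity) (by positivity) hr0.le ?_ ?_ ?_ ?_
    · have : Real.sqrt m ≤ (m : ℝ) ^ r := by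
        rw [Real.sqrt_eq_rpow]
        exact Real.rpow_le_rpow_of_exponent_le hm1 hr
      refine le_trans ?_ (mul_le_mul_of_nonneg_left this (by norm_num))
      apply Real.sqrt_le_iff.2 ⟨by positivity, ?_⟩
      rw [mul_pow, Real.sq_sqrt (by positivity)]
      linarith
    · have h := Real.pow_div_factorial_le_exp (m : ℝ) (by positivity) m
      rw [div_le_iff₀ (by positivity)] at h
      refine h.trans ?_
      rw [mul_pow, ← Real.exp_nat_mul, mul_one, mul_one]
      calc _ ≤ Real.exp m * (2 ^ m * (k ! * l !)) := by gcongr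
        _ = _ := by ring
    · rw [Real.mul_rpow (by norm_num) (by positivity), Real.rpow_add_one (by norm_num)]
      rw [le_div_iff₀ hmin]
      calc _ ≤ 2 * (2 ^ r * Real.exp 1 ^ r) * 1 := by
            gcongr
            exact min_le_right _ _
        _ = _ := by ring
    · rw [Real.one_rpow]
      exact Real.one_le_exp (by positivity)

/-- Estimate (6.5) of Lemma 6.4, for `n ≥ 1`. -/
theorem hermite_weighted_L2_refined_bound (r ε : ℝ) (hr : 1 / 2 ≤ r) (hε : 0 < ε)
    (n k l : ℕ) (hn : 1 ≤ n) :
    eLpNorm (fun x : ℝ => x ^ k * iteratedDeriv l (hermiteFun n) x) 2 volume ≤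
      ENNReal.ofReal (Real.sqrt 2 * Real.exp (ε * r * (n : ℝ) ^ (1 / (2 * r))) *
        (2 ^ (r + 1) * Real.exp 1 ^ r / min (ε ^ r) 1) ^ (k + l) *
        ((k ! : ℝ)) ^ r * ((l ! : ℝ)) ^ r) := by
  refine (hermite_crude k l n).trans (ENNReal.ofReal_le_ofReal ?_)
  have h := num_bound r ε hr hε n k l hn
  have h1 : 1 ≤ Real.sqrt 2 := Real.one_le_sqrt.2 (by norm_num)
  have h0 : (0:ℝ) ≤ Real.sqrt (2 * (n + (k + l : ℕ))) ^ (k + l) := by positivity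
  refine h.trans ?_
  rw [Real.mul_rpow (by positivity) (by positivity)] at h ⊢
  have := le_mul_of_one_le_left (h0.trans h) h1
  refine this.trans (le_of_eq ?_)
  ring
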